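/- arXiv:2411.02942 — 10 statements merged into one kernel-verified Lean document; each statement's English description precedes it below -/
import Mathlib

section
/- Let v be a monotone submodular set function on a finite ground set with v(∅) = 0, and let R > 0. Then the truncated function v^{(R)} defined by v^{(R)}(S) = ∫_0^1 v({j ∈ S : θ·v({j}) ≤ R}) dθ is monotone and submodular, and for every element j of the ground set, v^{(R)}({j}) = min(v({j}), R); in particular v^{(R)}({j}) ≤ R. -/
open MeasureTheory

/-- The truncation of a set function `v` by `R`:
`v^{(R)}(S) = ∫_0^1 v({j ∈ S : θ·v({j}) ≤ R}) dθ`. -/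
noncomputable def truncate {M : Type*} (v : Finset M → ℝ) (R : ℝ) (S : Finset M) : ℝ :=
  ∫ θ in (0:ℝ)..1, v (S.filter (fun j => θ * v {j} ≤ R))

theorem trunc_int {M : Type*}
    (v : Finset M → ℝ)
    (hmono : ∀ S T : Finset M, S ⊆ T → v S ≤ v T)
    (h0 : v ∅ = 0) (R : ℝ) (S : Finset M) :
    IntervalIntegrable (fun θ : ℝ => v (S.filter (fun j => θ * v {j} ≤ R))) volume 0 1 := by
  apply AntitoneOn.intervalIntegrable
  intro a _ b _ hab
  apply hmono
  intro j hj
  rw [Finset.mem_filter] at hj ⊢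
  have hv : 0 ≤ v {j} := h0 ▸ hmono ∅ {j} (Finset.empty_subset _)
  exact ⟨hj.1, (mul_le_mul_of_nonneg_right hab hv).trans hj.2⟩

theorem trunc_single {M : Type*}
    (v : Finset M → ℝ)
    (hmono : ∀ S T : Finset M, S ⊆ T → v S ≤ v T)
    (h0 : v ∅ = 0) (R : ℝ) (hR : 0 < R) (j : M) :
    truncate v R {j} = min (v {j}) R := by
  have hv : 0 ≤ v {j} := h0 ▸ hmono ∅ {j} (Finset.empty_subset _)
  have key : ∀ θ : ℝ, v (({j} : Finset M).filter (fun i => θ * v {i} ≤ R))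
      = if θ * v {j} ≤ R then v {j} else 0 := by
    intro θ
    rw [Finset.filter_singleton]
    split_ifs <;> simp [h0]
  have hi := trunc_int v hmono h0 R {j}
  unfold truncate
  simp only [key] at hi ⊢
  rcases le_or_gt (v {j}) R with h | h
  · rw [min_eq_left h]
    have : ∫ θ in (0:ℝ)..1, (if θ * v {j} ≤ R then v {j} else 0) = ∫ θ in (0:ℝ)..1, v {j} := by
      apply intervalIntegral.integral_congr
      intro θ hθ
      rw [Set.uIcc_of_le zero_le_one] at hθ
      have : θ * v {j} ≤ R := by nlinarith [hθ.1, hθ.2]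
      simp [this]
    rw [this]; simp
  · rw [min_eq_right h.le]
    have hc : 0 < v {j} := hR.trans h
    have h1 : R / v {j} ≤ 1 := (div_le_one hc).2 h.le
    have h2 : 0 ≤ R / v {j} := by positivity
    have e1 : ∫ θ in (0:ℝ)..(R / v {j}), (if θ * v {j} ≤ R then v {j} else 0)
        = ∫ θ in (0:ℝ)..(R / v {j}), v {j} := by
      apply intervalIntegral.integral_congr
      intro θ hθ
      rw [Set.uIcc_of_le h2] at hθ
      have : θ * v {j} ≤ R := (le_div_iff₀ hc).1 hθ.2
      simp [this]
    have e2 : ∫ θ in (R / v {j})..1, (if θ * v {j} ≤ R then v {j} else 0)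
        = ∫ θ in (R / v {j})..1, (0:ℝ) := by
      apply intervalIntegral.integral_congr_ae
      refine Filter.Eventually.of_forall ?_
      intro θ hθ
      rw [Set.uIoc_of_le h1] at hθ
      have : ¬ θ * v {j} ≤ R := not_le.2 ((div_lt_iff₀ hc).1 hθ.1)
      simp [this]
    rw [← intervalIntegral.integral_add_adjacent_intervals (b := R / v {j}), e1, e2]
    · simp [hc.ne']
    · exact hi.mono_set (by rw [Set.uIcc_of_le h2, Set.uIcc_of_le zero_le_one]; exact Set.Icc_subset_Icc_right h1)
    · exact hi.mono_set (by rw [Set.uIcc_of_le h1, Set.uIcc_of_le zero_le_one]; exact Set.Icc_subset_Icc_left h2)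

theorem stmt0 {M : Type*} [Fintype M] [DecidableEq M]
    (v : Finset M → ℝ)
    (hmono : ∀ S T : Finset M, S ⊆ T → v S ≤ v T)
    (hsub : ∀ S T : Finset M, v S + v T ≥ v (S ∩ T) + v (S ∪ T))
    (h0 : v ∅ = 0) (R : ℝ) (hR : 0 < R) :
    (∀ S T : Finset M, S ⊆ T → truncate v R S ≤ truncate v R T) ∧
    (∀ S T : Finset M, truncate v R S + truncate v R T ≥
      truncate v R (S ∩ T) + truncate v R (S ∪ T)) ∧
    (∀ j : M, truncate v R {j} = min (v {j}) R) ∧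
    (∀ j : M, truncate v R {j} ≤ R) := by
  have hi := trunc_int v hmono h0 R
  have hs := trunc_single v hmono h0 R hR
  refine ⟨?_, ?_, hs, fun j => (hs j).trans_le (min_le_right _ _)⟩
  · intro S T hST
    exact intervalIntegral.integral_mono_on zero_le_one (hi S) (hi T)
      fun θ _ => hmono _ _ (Finset.filter_subset_filter _ hST)
  · intro S T
    unfold truncate
    rw [ge_iff_le, ← intervalIntegral.integral_add (hi _) (hi _),
      ← intervalIntegral.integral_add (hi _) (hi _)]
    refine intervalIntegral.integral_mono_on zero_le_one ((hi _).add (hi _)) ((hi _).add (hi _)) ?_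
    intro θ _
    have := hsub (S.filter (fun j => θ * v {j} ≤ R)) (T.filter (fun j => θ * v {j} ≤ R))
    rw [← Finset.filter_inter_distrib, ← Finset.filter_union] at this
    exact this
end

section
/- Let v be a monotone submodular set function on a finite ground set M with v(∅) = 0, let R' ≥ R > 0 be reals, and let S ⊆ M be a nonempty set such that v({j}) ≤ R' for every j ∈ S. Then v(S) ≥ v^{(R)}(S) ≥ (R/R')·v(S), where v^{(R)} is the truncation of v by R. -/
open MeasureTheory

theorem stmt1 {M : Type*} [Fintype M] [DecidableEq M]
    (v : Finset M → ℝ)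
    (hmono : ∀ S T : Finset M, S ⊆ T → v S ≤ v T)
    (hsub : ∀ S T : Finset M, v S + v T ≥ v (S ∩ T) + v (S ∪ T))
    (h0 : v ∅ = 0) (R R' : ℝ) (hR : 0 < R) (hRR' : R ≤ R')
    (S : Finset M) (hS : S.Nonempty) (hbound : ∀ j ∈ S, v {j} ≤ R') :
    v S ≥ truncate v R S ∧ truncate v R S ≥ (R / R') * v S := by
  have hR' : 0 < R' := lt_of_lt_of_le hR hRR'
  have hv : ∀ T : Finset M, 0 ≤ v T := fun T => h0 ▸ hmono ∅ T (Finset.empty_subset T)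
  set g : ℝ → ℝ := fun θ => v (S.filter (fun j => θ * v {j} ≤ R)) with hg
  have hanti : Antitone g := by
    intro a b hab
    apply hmono
    intro j hj
    rw [Finset.mem_filter] at hj ⊢
    exact ⟨hj.1, le_trans (mul_le_mul_of_nonneg_right hab (hv {j})) hj.2⟩
  have hint : ∀ a b : ℝ, IntervalIntegrable g volume a b := fun a b => hanti.intervalIntegrable
  have htr : truncate v R S = ∫ θ in (0:ℝ)..1, g θ := rfl
  rw [htr]
  constructor
  · have h := intervalIntegral.integral_mono_on (μ := volume) (zero_le_one' ℝ) (hint 0 1)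
      (intervalIntegrable_const (c := v S)) (fun θ _ => hmono _ _ (Finset.filter_subset _ S))
    simpa using h
  · have hc0 : 0 ≤ R / R' := by positivity
    have hc1 : R / R' ≤ 1 := (div_le_one hR').2 hRR'
    rw [← intervalIntegral.integral_add_adjacent_intervals (hint 0 (R / R')) (hint (R / R') 1)]
    have h2 : 0 ≤ ∫ θ in (R / R')..1, g θ :=
      intervalIntegral.integral_nonneg hc1 (fun θ _ => hv _)
    have h1 := intervalIntegral.integral_mono_on (μ := volume) hc0
      (intervalIntegrable_const (c := v S)) (hint 0 (R / R')) (fun θ hθ => by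
        apply hmono
        intro j hj
        rw [Finset.mem_filter]
        refine ⟨hj, ?_⟩
        calc θ * v {j} ≤ (R / R') * R' :=
              mul_le_mul hθ.2 (hbound j hj) (hv _) hc0
          _ = R := div_mul_cancel₀ R hR'.ne')
    simp only [intervalIntegral.integral_const, sub_zero, smul_eq_mul] at h1
    linarith
end

section
/- Let c : M → ℝ≥0 be nonnegative weights on a finite ground set M and let v be the additive set function v(S) = ∑_{j∈S} c_j. Then for every R > 0 and every S ⊆ M, the truncation of v by R satisfies v^{(R)}(S) = ∑_{j∈S} min(R, c_j). -/
open MeasureTheory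

theorem aux_fun (a R : ℝ) (ha : 0 < a) :
    (fun θ : ℝ => if θ * a ≤ R then a else 0) = (Set.Iic (R / a)).indicator (fun _ => a) := by
  funext θ
  simp only [Set.indicator, Set.mem_Iic, le_div_iff₀ ha]

theorem aux_int (a R : ℝ) (ha : 0 ≤ a) :
    IntervalIntegrable (fun θ : ℝ => if θ * a ≤ R then a else 0) volume 0 1 := by
  rcases ha.eq_or_lt with h | h
  · subst h
    simp
  · rw [aux_fun a R h, intervalIntegrable_iff_integrableOn_Ioc_of_le zero_le_one]
    exact (integrableOn_const (by simp)).indicator measurableSet_Iic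

theorem aux_val (a R : ℝ) (ha : 0 ≤ a) (hR : 0 < R) :
    ∫ θ in (0:ℝ)..1, (if θ * a ≤ R then a else 0) = min R a := by
  rcases ha.eq_or_lt with h | h
  · subst h
    simp [hR.le]
  · rw [aux_fun a R h, intervalIntegral.integral_of_le zero_le_one,
      setIntegral_indicator measurableSet_Iic, Set.Ioc_inter_Iic, setIntegral_const]
    have h0 : 0 ≤ min 1 (R / a) := le_min zero_le_one (by positivity)
    rw [Real.volume_real_Ioc_of_le h0, sub_zero, smul_eq_mul, min_mul_of_nonneg _ _ ha,
      one_mul, div_mul_cancel₀ _ h.ne', min_comm]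

theorem stmt2 {M : Type*} [Fintype M] [DecidableEq M]
    (c : M → ℝ) (hc : ∀ j, 0 ≤ c j)
    (v : Finset M → ℝ) (hv : ∀ S : Finset M, v S = ∑ j ∈ S, c j)
    (R : ℝ) (hR : 0 < R) (S : Finset M) :
    truncate v R S = ∑ j ∈ S, min R (c j) := by
  unfold truncate
  simp only [hv, Finset.sum_singleton, Finset.sum_filter]
  rw [intervalIntegral.integral_finsetSum (fun j _ => aux_int (c j) R (hc j))]
  exact Finset.sum_congr rfl (fun j _ => aux_val (c j) R (hc j) hR)
end

section
/- Let v be a monotone nonnegative submodular set function on the finite ground set {1,…,n} with v(∅) = 0, let F be its multilinear extension, and let x ∈ [0,1]^n. Then: (i) for every function α assigning a nonnegative real α_S to each S ⊆ {1,…,n} such that ∑_S α_S ≤ 1 and ∑_{S : j ∈ S} α_S = x_j for every coordinate j, one has F(x) ≥ (1 − 1/e)·∑_S α_S·v(S); and (ii) there exists such an α with ∑_S α_S·v(S) ≥ F(x). (Equivalently, f⁺(x) ≥ F(x) ≥ (1 − 1/e)·f⁺(x), where f⁺ is the concave extension of v.) -/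
/-- The multilinear extension of a set function `v` on ground set `{1,…,n}`:
`F(x) = ∑_{S ⊆ [n]} v(S) ∏_{j∈S} x_j ∏_{j∉S} (1 - x_j)`. -/
noncomputable def multilinear (n : ℕ) (v : Finset (Fin n) → ℝ) (x : Fin n → ℝ) : ℝ :=
  ∑ S : Finset (Fin n), v S * ((∏ j ∈ S, x j) * ∏ j ∈ Sᶜ, (1 - x j))

noncomputable def ww {n : ℕ} (x : Fin n → ℝ) (S : Finset (Fin n)) (j : Fin n) : ℝ :=
  if j ∈ S then x j else 1 - x j

noncomputable def WW {n : ℕ} (x : Fin n → ℝ) (S : Finset (Fin n)) : ℝ := ∏ j, ww x S j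

noncomputable def QQ {n : ℕ} (x : Fin n → ℝ) (j : Fin n) (S : Finset (Fin n)) : ℝ :=
  ∏ i ∈ Finset.univ.erase j, ww x S i

theorem WW_eq {n : ℕ} (x : Fin n → ℝ) (S : Finset (Fin n)) :
    WW x S = (∏ j ∈ S, x j) * ∏ j ∈ Sᶜ, (1 - x j) := by
  unfold WW
  rw [← Finset.prod_mul_prod_compl S]
  congr 1
  · exact Finset.prod_congr rfl fun j hj => by simp [ww, hj]
  · exact Finset.prod_congr rfl fun j hj => by
      have := Finset.mem_compl.1 hj
      simp [ww, this]

theorem ml_eq {n : ℕ} (v : Finset (Fin n) → ℝ) (x : Fin n → ℝ) :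
    multilinear n v x = ∑ S, v S * WW x S := by
  simp only [multilinear, WW_eq]

theorem WW_nonneg {n : ℕ} (x : Fin n → ℝ) (hx : ∀ j, x j ∈ Set.Icc (0:ℝ) 1)
    (S : Finset (Fin n)) : 0 ≤ WW x S := by
  refine Finset.prod_nonneg fun j _ => ?_
  have := hx j
  unfold ww
  split_ifs
  · exact this.1
  · linarith [this.2]

theorem WW_sum {n : ℕ} (x : Fin n → ℝ) : ∑ S, WW x S = 1 := by
  have h := Finset.prod_add x (fun j => 1 - x j) Finset.univ
  simp only [add_sub_cancel, Finset.prod_const_one, Finset.powerset_univ] at h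
  rw [h]
  refine Finset.sum_congr rfl fun S _ => ?_
  rw [WW_eq, Finset.compl_eq_univ_sdiff]

theorem WW_QQ {n : ℕ} (x : Fin n → ℝ) (j : Fin n) (S : Finset (Fin n)) :
    WW x S = ww x S j * QQ x j S :=
  (Finset.mul_prod_erase _ _ (Finset.mem_univ j)).symm

theorem QQ_congr {n : ℕ} (x : Fin n → ℝ) (j : Fin n) (S T : Finset (Fin n))
    (h : ∀ i, i ≠ j → (i ∈ S ↔ i ∈ T)) : QQ x j S = QQ x j T := by
  refine Finset.prod_congr rfl fun i hi => ?_
  have := h i (Finset.ne_of_mem_erase hi)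
  simp [ww, this]

theorem sum_pair {n : ℕ} (j : Fin n) (a : Finset (Fin n) → ℝ) :
    ∑ S, a S = ∑ S ∈ Finset.univ.filter (fun S => j ∉ S), (a S + a (insert j S)) := by
  rw [← Finset.sum_filter_add_sum_filter_not Finset.univ (fun S => j ∉ S) a,
    Finset.sum_add_distrib]
  congr 1
  refine Finset.sum_nbij' (fun S => S.erase j) (fun S => insert j S) ?_ ?_ ?_ ?_ ?_ <;>
    intro S hS <;> simp at hS ⊢ <;> simp [hS]

theorem marg {n : ℕ} (x : Fin n → ℝ) (j : Fin n) :
    (∑ S, if j ∈ S then WW x S else 0) = x j := by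
  have : x j = ∑ S, x j * WW x S := by rw [← Finset.mul_sum, WW_sum, mul_one]
  rw [this, sum_pair j, sum_pair j (fun S => x j * WW x S)]
  refine Finset.sum_congr rfl fun S hS => ?_
  have hj : j ∉ S := by simpa using hS
  have hq : QQ x j (insert j S) = QQ x j S := QQ_congr _ _ _ _ fun i hi => by simp [hi]
  simp only [WW_QQ x j, hq]
  simp [ww, hj]
  ring

theorem partial_eq {n : ℕ} (v : Finset (Fin n) → ℝ) (x : Fin n → ℝ) (j : Fin n) :
    ∑ S, v S * (QQ x j S * (if j ∈ S then 1 else -1))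
      = ∑ S, (v (insert j S) - v (S.erase j)) * WW x S := by
  rw [sum_pair j, sum_pair j (fun S => (v (insert j S) - v (S.erase j)) * WW x S)]
  refine Finset.sum_congr rfl fun S hS => ?_
  have hj : j ∉ S := by simpa using hS
  have hq : QQ x j (insert j S) = QQ x j S := QQ_congr _ _ _ _ fun i hi => by simp [hi]
  simp only [WW_QQ x j, hq]
  simp [ww, hj]
  ring

theorem submod_sum {n : ℕ} (v : Finset (Fin n) → ℝ)
    (hsub : ∀ S T : Finset (Fin n), v S + v T ≥ v (S ∩ T) + v (S ∪ T))
    (hmono : ∀ S T : Finset (Fin n), S ⊆ T → v S ≤ v T)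
    (R S : Finset (Fin n)) :
    v S - v R ≤ ∑ j ∈ S, (v (insert j R) - v (R.erase j)) := by
  have key : ∀ S : Finset (Fin n),
      v (R ∪ S) - v R ≤ ∑ j ∈ S, (v (insert j R) - v (R.erase j)) := by
    intro S
    induction S using Finset.induction_on with
    | empty => simp
    | insert a S ha ih =>
      rw [Finset.sum_insert ha]
      have h1 := hsub (R ∪ S) (insert a R)
      have h2 : (R ∪ S) ∪ insert a R = R ∪ insert a S := by ext; simp; tauto
      have h3 := hmono R ((R ∪ S) ∩ insert a R) (by
        intro i hi; simp [hi])
      have h4 := hmono _ _ (Finset.erase_subset a R)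
      rw [h2] at h1
      linarith
  have := hmono S (R ∪ S) Finset.subset_union_right
  linarith [key S]

theorem deriv_ml {n : ℕ} (v : Finset (Fin n) → ℝ) (x : Fin n → ℝ) (t : ℝ) :
    HasDerivAt (fun t : ℝ => multilinear n v (fun j => t * x j))
      (∑ j, x j * ∑ S, (v (insert j S) - v (S.erase j)) * WW (fun j => t * x j) S) t := by
  have hw : ∀ S j, HasDerivAt (fun t : ℝ => ww (fun j => t * x j) S j)
      (x j * (if j ∈ S then 1 else -1)) t := by
    intro S j
    have h1 : HasDerivAt (fun t : ℝ => t * x j) (x j) t := by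
      simpa using (hasDerivAt_id t).mul_const (x j)
    by_cases hj : j ∈ S
    · simpa [ww, hj] using h1
    · simpa [ww, hj] using h1.const_sub 1
  have h : HasDerivAt (fun t : ℝ => ∑ S, v S * WW (fun j => t * x j) S)
      (∑ S, v S * ∑ j, QQ (fun j => t * x j) j S * (x j * (if j ∈ S then 1 else -1))) t := by
    refine HasDerivAt.fun_sum fun S _ => ?_
    refine HasDerivAt.const_mul _ ?_
    have := HasDerivAt.fun_finsetProd (u := Finset.univ) (fun j _ => hw S j)
    simpa [WW, QQ] using this
  simp only [ml_eq]
  convert h using 1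
  simp only [← partial_eq, Finset.mul_sum]
  rw [Finset.sum_comm]
  exact Finset.sum_congr rfl fun S _ => Finset.sum_congr rfl fun j _ => by ring

theorem stmt3 (n : ℕ) (v : Finset (Fin n) → ℝ)
    (hmono : ∀ S T : Finset (Fin n), S ⊆ T → v S ≤ v T)
    (hsub : ∀ S T : Finset (Fin n), v S + v T ≥ v (S ∩ T) + v (S ∪ T))
    (hnn : ∀ S : Finset (Fin n), 0 ≤ v S) (h0 : v ∅ = 0)
    (x : Fin n → ℝ) (hx : ∀ j, x j ∈ Set.Icc (0:ℝ) 1) :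
    (∀ α : Finset (Fin n) → ℝ,
      (∀ S, 0 ≤ α S) →
      (∑ S : Finset (Fin n), α S ≤ 1) →
      (∀ j : Fin n, (∑ S : Finset (Fin n), if j ∈ S then α S else 0) = x j) →
      multilinear n v x ≥ (1 - 1 / Real.exp 1) * ∑ S : Finset (Fin n), α S * v S) ∧
    (∃ α : Finset (Fin n) → ℝ,
      (∀ S, 0 ≤ α S) ∧
      (∑ S : Finset (Fin n), α S ≤ 1) ∧
      (∀ j : Fin n, (∑ S : Finset (Fin n), if j ∈ S then α S else 0) = x j) ∧
      (∑ S : Finset (Fin n), α S * v S) ≥ multilinear n v x) := by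
  refine ⟨?_, WW x, WW_nonneg x hx, (WW_sum x).le, marg x, ?_⟩
  swap
  · rw [ml_eq]
    exact (Finset.sum_congr rfl fun S _ => mul_comm _ _).le
  intro α hα hα1 hαx
  set L := ∑ S : Finset (Fin n), α S * v S with hL
  have hml : ∀ y : Fin n → ℝ, (∀ j, y j ∈ Set.Icc (0:ℝ) 1) → 0 ≤ multilinear n v y := by
    intro y hy
    rw [ml_eq]
    exact Finset.sum_nonneg fun S _ => mul_nonneg (hnn S) (WW_nonneg y hy S)
  have hty : ∀ t ∈ Set.Icc (0:ℝ) 1, ∀ j, t * x j ∈ Set.Icc (0:ℝ) 1 := fun t ht j =>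
    ⟨mul_nonneg ht.1 (hx j).1, mul_le_one₀ ht.2 (hx j).1 (hx j).2⟩
  have hd : ∀ t ∈ Set.Icc (0:ℝ) 1, L - multilinear n v (fun j => t * x j) ≤
      ∑ j, x j * ∑ S, (v (insert j S) - v (S.erase j)) * WW (fun j => t * x j) S := by
    intro t ht
    have hy := hty t ht
    have hF := hml _ hy
    have hW := WW_nonneg _ hy
    generalize (fun j => t * x j) = y at *
    have e1 : ∑ j, x j * ∑ R, (v (insert j R) - v (R.erase j)) * WW y R
        = ∑ S, α S * ∑ R, (∑ j ∈ S, (v (insert j R) - v (R.erase j))) * WW y R := by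
      obtain ⟨D, hD⟩ : ∃ D : Fin n → ℝ,
          ∀ j, ∑ R, (v (insert j R) - v (R.erase j)) * WW y R = D j := ⟨_, fun _ => rfl⟩
      have : ∀ S, (∑ R, (∑ j ∈ S, (v (insert j R) - v (R.erase j))) * WW y R)
          = ∑ j, if j ∈ S then D j else 0 := by
        intro S
        simp only [Finset.sum_mul]
        rw [Finset.sum_comm]
        simp [hD]
      simp only [this, hD]
      simp only [Finset.mul_sum]
      rw [Finset.sum_comm]
      refine Finset.sum_congr rfl fun j _ => ?_
      rw [← hαx j, Finset.sum_mul]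
      refine Finset.sum_congr rfl fun S _ => ?_
      split_ifs <;> simp
    rw [e1]
    have e2 : ∀ S, v S - multilinear n v y ≤
        ∑ R, (∑ j ∈ S, (v (insert j R) - v (R.erase j))) * WW y R := by
      intro S
      have : v S - multilinear n v y = ∑ R, (v S - v R) * WW y R := by
        simp only [sub_mul, Finset.sum_sub_distrib, ← Finset.mul_sum, WW_sum, ml_eq, mul_one]
      rw [this]
      exact Finset.sum_le_sum fun R _ =>
        mul_le_mul_of_nonneg_right (submod_sum v hsub hmono R S) (hW R)
    calc L - multilinear n v y ≤ L - (∑ S, α S) * multilinear n v y := by nlinarith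
      _ = ∑ S, α S * (v S - multilinear n v y) := by
        simp only [mul_sub, Finset.sum_sub_distrib, Finset.sum_mul, hL]
      _ ≤ _ := Finset.sum_le_sum fun S _ => mul_le_mul_of_nonneg_left (e2 S) (hα S)
  have hder : ∀ t : ℝ, HasDerivAt
      (fun t => Real.exp t * (multilinear n v (fun j => t * x j) - L)) _ t := fun t =>
    (Real.hasDerivAt_exp t).mul ((deriv_ml v x t).sub_const L)
  have hm : MonotoneOn (fun t => Real.exp t * (multilinear n v (fun j => t * x j) - L))
      (Set.Icc (0:ℝ) 1) := by
    refine monotoneOn_of_deriv_nonneg (convex_Icc 0 1)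
      (fun t _ => (hder t).continuousAt.continuousWithinAt)
      (fun t _ => (hder t).differentiableAt.differentiableWithinAt) ?_
    intro t ht
    rw [(hder t).deriv, ← mul_add]
    have := hd t (interior_subset ht)
    exact mul_nonneg (Real.exp_pos t).le (by linarith)
  have h := hm (Set.left_mem_Icc.2 zero_le_one) (Set.right_mem_Icc.2 zero_le_one) zero_le_one
  have hz := hml _ (hty 0 (by simp))
  simp only [Real.exp_zero, one_mul] at h
  have he := Real.exp_pos 1
  have h2 : -L / Real.exp 1 ≤ multilinear n v x - L := by
    rw [div_le_iff₀ he]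
    linarith
  have h3 : (1 - 1 / Real.exp 1) * L = L + -L / Real.exp 1 := by ring
  rw [h3]
  linarith
end

section
/- Let v be a submodular set function on {1,…,n}, let F : [0,1]^n → ℝ be its multilinear extension, let a ≠ b be two coordinates, and let x ∈ [0,1]^n. Then the function s ↦ F(x + s·(e_a − e_b)) is convex on the interval of values of s for which x + s·(e_a − e_b) ∈ [0,1]^n, where e_a and e_b denote standard basis vectors. -/
/-- The direction `e_a - e_b` (difference of standard basis vectors). -/
def dir (n : ℕ) (a b : Fin n) : Fin n → ℝ :=
  fun j => (if j = a then 1 else 0) - (if j = b then 1 else 0)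

theorem multilinear_split (n : ℕ) (v : Finset (Fin n) → ℝ) (a b : Fin n) (hab : a ≠ b)
    (y : Fin n → ℝ) :
    multilinear n v y = ∑ R ∈ (({a, b} : Finset (Fin n))ᶜ).powerset,
      ((∏ j ∈ R, y j) * ∏ j ∈ (({a, b} : Finset (Fin n))ᶜ) \ R, (1 - y j)) *
      (v R * ((1 - y a) * (1 - y b)) + v (insert b R) * ((1 - y a) * y b)
        + v (insert a R) * (y a * (1 - y b)) + v (insert a (insert b R)) * (y a * y b)) := by
  set U : Finset (Fin n) := ({a, b} : Finset (Fin n))ᶜ with hU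
  have haU : a ∉ U := by simp [hU]
  have hbU : b ∉ U := by simp [hU]
  have huniv : (Finset.univ : Finset (Fin n)) = insert a (insert b U) := by
    ext j; simp [hU]; tauto
  unfold multilinear
  have haU' : a ∉ insert b U := by simp [haU, hab]
  rw [← Finset.powerset_univ, huniv, Finset.sum_powerset_insert haU',
    Finset.sum_powerset_insert hbU, Finset.sum_powerset_insert hbU,
    ← Finset.sum_add_distrib, ← Finset.sum_add_distrib, ← Finset.sum_add_distrib]
  refine Finset.sum_congr rfl fun R hR => ?_
  rw [Finset.mem_powerset] at hR
  have haR : a ∉ R := fun h => haU (hR h)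
  have hbR : b ∉ R := fun h => hbU (hR h)
  have haD : a ∉ U \ R := by simp [haU]
  have hbD : b ∉ U \ R := by simp [hbU]
  have haD' : a ∉ insert b (U \ R) := by simp [haU, hab]
  have haR' : a ∉ insert b R := by simp [haR, hab]
  have e1 : Rᶜ = insert a (insert b (U \ R)) := by
    ext j; simp [hU]; grind
  have e2 : (insert b R)ᶜ = insert a (U \ R) := by
    ext j; simp [hU]; grind
  have e3 : (insert a R)ᶜ = insert b (U \ R) := by
    ext j; simp [hU]; grind
  have e4 : (insert a (insert b R))ᶜ = U \ R := by
    ext j; simp [hU]; grind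
  rw [e1, e2, e3, e4, Finset.prod_insert haD', Finset.prod_insert hbD, Finset.prod_insert haD,
    Finset.prod_insert haR', Finset.prod_insert hbR, Finset.prod_insert haR]
  ring

theorem stmt4 (n : ℕ) (v : Finset (Fin n) → ℝ)
    (hsub : ∀ S T : Finset (Fin n), v S + v T ≥ v (S ∩ T) + v (S ∪ T))
    (a b : Fin n) (hab : a ≠ b)
    (x : Fin n → ℝ) (hx : ∀ j, x j ∈ Set.Icc (0:ℝ) 1) :
    ConvexOn ℝ {s : ℝ | ∀ j, x j + s * dir n a b j ∈ Set.Icc (0:ℝ) 1}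
      (fun s => multilinear n v (fun j => x j + s * dir n a b j)) := by
  have hda : dir n a b a = 1 := by simp [dir, hab]
  have hdb : dir n a b b = -1 := by simp [dir, hab.symm]
  have hd : ∀ j ∈ ({a, b} : Finset (Fin n))ᶜ, dir n a b j = 0 := by
    intro j hj
    simp at hj
    simp [dir, hj.1, hj.2]
  constructor
  · intro s hs t ht α β hα hβ h1 j
    have h := convex_Icc (0:ℝ) 1 (hs j) (ht j) hα hβ h1
    have e : x j + (α • s + β • t) * dir n a b j
        = α • (x j + s * dir n a b j) + β • (x j + t * dir n a b j) := by
      simp only [smul_eq_mul]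
      linear_combination (-x j) * h1
    rw [e]; exact h
  · intro s hs t ht α β hα hβ h1
    simp only [multilinear_split n v a b hab, hda, hdb, smul_eq_mul]
    rw [Finset.mul_sum, Finset.mul_sum, ← Finset.sum_add_distrib]
    refine Finset.sum_le_sum fun R hR => ?_
    rw [Finset.mem_powerset] at hR
    have key : ∀ s : ℝ, ((∏ j ∈ R, (x j + s * dir n a b j)) *
        ∏ j ∈ (({a, b} : Finset (Fin n))ᶜ) \ R, (1 - (x j + s * dir n a b j)))
        = (∏ j ∈ R, x j) * ∏ j ∈ (({a, b} : Finset (Fin n))ᶜ) \ R, (1 - x j) := by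
      intro s
      congr 1
      · exact Finset.prod_congr rfl fun j hj => by rw [hd j (hR hj)]; ring
      · exact Finset.prod_congr rfl fun j hj => by
          rw [hd j (Finset.mem_sdiff.1 hj).1]; ring
    rw [key, key, key]
    have hP : 0 ≤ (∏ j ∈ R, x j) * ∏ j ∈ (({a, b} : Finset (Fin n))ᶜ) \ R, (1 - x j) :=
      mul_nonneg (Finset.prod_nonneg fun j _ => (hx j).1)
        (Finset.prod_nonneg fun j _ => sub_nonneg.2 (hx j).2)
    generalize (∏ j ∈ R, x j) * ∏ j ∈ (({a, b} : Finset (Fin n))ᶜ) \ R, (1 - x j) = P at hP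
    have hs' := hsub (insert a R) (insert b R)
    have haR : a ∉ R := fun h => by simpa using hR h
    have hbR : b ∉ R := fun h => by simpa using hR h
    have i1 : insert a R ∩ insert b R = R := by ext j; simp; grind
    have i2 : insert a R ∪ insert b R = insert a (insert b R) := by ext j; simp; grind
    rw [i1, i2] at hs'
    have hA : 0 ≤ v (insert a R) + v (insert b R) - v R - v (insert a (insert b R)) := by
      linarith
    have hfin := mul_nonneg (mul_nonneg hP hA) (mul_nonneg (mul_nonneg hα hβ) (sq_nonneg (s - t)))
    obtain rfl : β = 1 - α := by linarith
    rw [← sub_nonneg]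
    refine hfin.trans_eq ?_
    ring
end

section
/- Let v be a monotone submodular set function on a finite ground set M and let θ ≤ 0 be a real. Then the set function h(S) = exp(θ·v(S)) is supermodular, i.e., h(S ∪ T) + h(S ∩ T) ≥ h(S) + h(T) for all S, T ⊆ M. -/
theorem stmt5 {M : Type*} [Fintype M] [DecidableEq M]
    (v : Finset M → ℝ)
    (hmono : ∀ S T : Finset M, S ⊆ T → v S ≤ v T)
    (hsub : ∀ S T : Finset M, v S + v T ≥ v (S ∩ T) + v (S ∪ T))
    (θ : ℝ) (hθ : θ ≤ 0) :
    ∀ S T : Finset M,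
      Real.exp (θ * v (S ∪ T)) + Real.exp (θ * v (S ∩ T)) ≥
        Real.exp (θ * v S) + Real.exp (θ * v T) := by
  intro S T
  have h1 : Real.exp (θ * v S) ≤ Real.exp (θ * v (S ∩ T)) :=
    Real.exp_le_exp.2 (mul_le_mul_of_nonpos_left (hmono _ _ Finset.inter_subset_left) hθ)
  have h2 : Real.exp (θ * v T) ≤ Real.exp (θ * v (S ∩ T)) :=
    Real.exp_le_exp.2 (mul_le_mul_of_nonpos_left (hmono _ _ Finset.inter_subset_right) hθ)
  have h3 : Real.exp (θ * v S) * Real.exp (θ * v T) ≤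
      Real.exp (θ * v (S ∩ T)) * Real.exp (θ * v (S ∪ T)) := by
    rw [← Real.exp_add, ← Real.exp_add]
    apply Real.exp_le_exp.2
    have := mul_le_mul_of_nonpos_left (hsub S T) hθ
    linarith
  have hC := Real.exp_pos (θ * v (S ∩ T))
  refine le_of_mul_le_mul_left ?_ hC
  nlinarith [mul_nonneg (sub_nonneg.2 h1) (sub_nonneg.2 h2)]
end

section
/- Let v be a monotone submodular set function on {1,…,n}, let t ∈ ℝ and θ ≤ 0, and define g(x) = e^{−θt} · ∑_{S ⊆ {1,…,n}} (∏_{j∈S} x_j ∏_{j∉S} (1 − x_j)) · e^{θ·v(S)} for x ∈ [0,1]^n. Then for any two distinct coordinates a, b, the function s ↦ g(x + s·(e_a − e_b)) is concave on the interval of s for which x + s·(e_a − e_b) ∈ [0,1]^n. -/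
theorem aux_exp (p q r m : ℝ) (h1 : q ≤ p) (h2 : r ≤ p) (h : q + r ≤ p + m) :
    Real.exp q + Real.exp r ≤ Real.exp p + Real.exp m := by
  have e1 := Real.exp_le_exp.2 h1
  have e2 := Real.exp_le_exp.2 h2
  have e3 := Real.exp_le_exp.2 h
  rw [Real.exp_add, Real.exp_add] at e3
  have hp := Real.exp_pos p
  have := mul_nonneg (sub_nonneg.2 e1) (sub_nonneg.2 e2)
  refine le_of_mul_le_mul_left ?_ hp
  nlinarith

theorem aux_quad (K α β p q r m : ℝ) (hK : 0 ≤ K) (h : q + r ≤ p + m) :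
    ConcaveOn ℝ Set.univ (fun s : ℝ => K * ((1 - (α + s)) * (1 - (β - s)) * p
      + (α + s) * (1 - (β - s)) * q + (1 - (α + s)) * (β - s) * r + (α + s) * (β - s) * m)) := by
  refine ⟨convex_univ, ?_⟩
  intro x _ y _ c d hc hd hcd
  simp only [smul_eq_mul]
  obtain rfl : d = 1 - c := by linarith
  have : 0 ≤ K * (p + m - q - r) * (c * (1 - c) * (x - y)^2) :=
    mul_nonneg (mul_nonneg hK (by linarith)) (mul_nonneg (mul_nonneg hc hd) (sq_nonneg _))
  rw [← sub_nonneg]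
  refine this.trans_eq ?_
  ring

theorem stmt6 (n : ℕ) (v : Finset (Fin n) → ℝ)
    (hmono : ∀ S T : Finset (Fin n), S ⊆ T → v S ≤ v T)
    (hsub : ∀ S T : Finset (Fin n), v S + v T ≥ v (S ∩ T) + v (S ∪ T))
    (t θ : ℝ) (hθ : θ ≤ 0)
    (a b : Fin n) (hab : a ≠ b)
    (x : Fin n → ℝ) (hx : ∀ j, x j ∈ Set.Icc (0:ℝ) 1) :
    ConcaveOn ℝ {s : ℝ | ∀ j, x j + s * dir n a b j ∈ Set.Icc (0:ℝ) 1}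
      (fun s => Real.exp (-θ * t) *
        ∑ S : Finset (Fin n),
          ((∏ j ∈ S, (x j + s * dir n a b j)) * ∏ j ∈ Sᶜ, (1 - (x j + s * dir n a b j))) *
            Real.exp (θ * v S)) := by
  have hconv : Convex ℝ {s : ℝ | ∀ j, x j + s * dir n a b j ∈ Set.Icc (0:ℝ) 1} := by
    intro y hy z hz c d hc hd hcd j
    have h1 := hy j
    have h2 := hz j
    simp only [Set.mem_Icc, smul_eq_mul] at *
    obtain rfl : d = 1 - c := by linarith
    constructor
    · nlinarith [mul_nonneg hc h1.1, mul_nonneg hd h2.1]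
    · nlinarith [mul_le_mul_of_nonneg_left h1.2 hc, mul_le_mul_of_nonneg_left h2.2 hd]
  refine ConcaveOn.subset ?_ (Set.subset_univ _) hconv
  have hba := hab.symm
  have da : dir n a b a = 1 := by simp [dir, hab]
  have db : dir n a b b = -1 := by simp [dir, hba]
  have dj : ∀ j, j ≠ a → j ≠ b → dir n a b j = 0 := by
    intro j h1 h2; simp [dir, h1, h2]
  let U : Finset (Fin n) := Finset.univ \ {a, b}
  have hU : (Finset.univ : Finset (Finset (Fin n))) = (insert a (insert b U)).powerset := by
    have : insert a (insert b U) = Finset.univ := by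
      ext j; simp [U]; tauto
    rw [this, Finset.powerset_univ]
  let K : Finset (Fin n) → ℝ := fun R => (∏ j ∈ R, x j) * ∏ j ∈ U \ R, (1 - x j)
  have hK : ∀ R, 0 ≤ K R := fun R => mul_nonneg (Finset.prod_nonneg fun j _ => (hx j).1)
    (Finset.prod_nonneg fun j _ => sub_nonneg.2 (hx j).2)
  let F : Finset (Fin n) → ℝ → ℝ := fun R s =>
    K R * ((1 - (x a + s)) * (1 - (x b - s)) * Real.exp (θ * v R)
      + (x a + s) * (1 - (x b - s)) * Real.exp (θ * v (insert a R))
      + (1 - (x a + s)) * (x b - s) * Real.exp (θ * v (insert b R))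
      + (x a + s) * (x b - s) * Real.exp (θ * v (insert a (insert b R))))
  have hF : ∀ R ∈ U.powerset, ConcaveOn ℝ Set.univ (F R) := by
    intro R hR
    have hR' := Finset.mem_powerset.1 hR
    have haR : a ∉ R := fun h => by simpa [U] using hR' h
    have hbR : b ∉ R := fun h => by simpa [U] using hR' h
    apply aux_quad _ _ _ _ _ _ _ (hK R)
    apply aux_exp
    · exact mul_le_mul_of_nonpos_left (hmono _ _ (Finset.subset_insert _ _)) hθ
    · exact mul_le_mul_of_nonpos_left (hmono _ _ (Finset.subset_insert _ _)) hθ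
    · have h := hsub (insert a R) (insert b R)
      have e1 : insert a R ∩ insert b R = R := by
        ext j; simp only [Finset.mem_inter, Finset.mem_insert]; grind
      have e2 : insert a R ∪ insert b R = insert a (insert b R) := by
        ext j; simp only [Finset.mem_union, Finset.mem_insert]; tauto
      rw [e1, e2] at h
      nlinarith
  have hsum : ∀ A ⊆ U.powerset, ConcaveOn ℝ Set.univ (fun s => ∑ R ∈ A, F R s) := by
    intro A
    induction A using Finset.induction_on with
    | empty => intro _; simpa using concaveOn_const (0:ℝ) convex_univ
    | insert R A hRA ih =>
      intro h
      simp only [Finset.sum_insert hRA]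
      exact (hF R (h (Finset.mem_insert_self _ _))).add
        (ih ((Finset.subset_insert _ _).trans h))
  have key := (hsum _ subset_rfl).smul (Real.exp_pos (-θ * t)).le
  refine key.congr fun s _ => Eq.symm ?_
  simp only [smul_eq_mul]
  congr 1
  have hbU : b ∉ U := by simp [U]
  have haU : a ∉ insert b U := by simp [U, hab]
  rw [hU, Finset.sum_powerset_insert haU, Finset.sum_powerset_insert hbU,
    Finset.sum_powerset_insert hbU, ← Finset.sum_add_distrib, ← Finset.sum_add_distrib,
    ← Finset.sum_add_distrib]
  refine Finset.sum_congr rfl fun R hR => ?_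
  have hR' := Finset.mem_powerset.1 hR
  have haR : a ∉ R := fun h => by simpa [U] using hR' h
  have hbR : b ∉ R := fun h => by simpa [U] using hR' h
  have hUm : ∀ j, j ∈ U ↔ (j ≠ a ∧ j ≠ b) := by intro j; simp [U]
  have c0 : Rᶜ = insert a (insert b (U \ R)) := by
    ext j; simp only [Finset.mem_compl, Finset.mem_insert, Finset.mem_sdiff, hUm]; grind
  have c1 : (insert a R)ᶜ = insert b (U \ R) := by
    ext j; simp only [Finset.mem_compl, Finset.mem_insert, Finset.mem_sdiff, hUm]; grind
  have c2 : (insert b R)ᶜ = insert a (U \ R) := by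
    ext j; simp only [Finset.mem_compl, Finset.mem_insert, Finset.mem_sdiff, hUm]; grind
  have c3 : (insert a (insert b R))ᶜ = U \ R := by
    ext j; simp only [Finset.mem_compl, Finset.mem_insert, Finset.mem_sdiff, hUm]; grind
  have m1 : a ∉ insert b R := by simp [hab, haR]
  have m2 : b ∉ U \ R := by simp [hUm]
  have m3 : a ∉ U \ R := by simp [hUm]
  have m4 : a ∉ insert b (U \ R) := by simp [hUm, hab]
  have p1 : ∏ j ∈ R, (x j + s * dir n a b j) = ∏ j ∈ R, x j := by
    refine Finset.prod_congr rfl fun j hj => ?_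
    have := (hUm j).1 (hR' hj)
    rw [dj j this.1 this.2]; ring
  have p2 : ∏ j ∈ U \ R, (1 - (x j + s * dir n a b j)) = ∏ j ∈ U \ R, (1 - x j) := by
    refine Finset.prod_congr rfl fun j hj => ?_
    have := (hUm j).1 (Finset.mem_sdiff.1 hj).1
    rw [dj j this.1 this.2]; ring
  rw [c0, c1, c2, c3, Finset.prod_insert m1, Finset.prod_insert m4, Finset.prod_insert haR,
    Finset.prod_insert hbR, Finset.prod_insert m2, Finset.prod_insert m3, p1, p2, da, db]
  simp only [F, K]
  ring
end

section
/- Let v be a monotone submodular set function on {1,…,n} with v(∅) = 0 and all marginal values at most 1 (i.e., v(S ∪ {i}) − v(S) ≤ 1 for all S and i). Let x ∈ [0,1]^n, let μ = F(x) be the value of the multilinear extension of v at x, let δ ∈ (0,1), θ = ln(1 − δ), and t = (1 − δ)·μ. Then e^{−θt} · ∑_{S ⊆ {1,…,n}} (∏_{j∈S} x_j ∏_{j∉S} (1 − x_j)) · e^{θ·v(S)} ≤ exp(−δ²μ/2). -/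
open Finset in
noncomputable def EA {n : ℕ} (x : Fin n → ℝ) (A : Finset (Fin n)) (f : Finset (Fin n) → ℝ) : ℝ :=
  ∑ S ∈ A.powerset, ((∏ j ∈ S, x j) * ∏ j ∈ A \ S, (1 - x j)) * f S

lemma EA_empty {n : ℕ} (x : Fin n → ℝ) (f : Finset (Fin n) → ℝ) : EA x ∅ f = f ∅ := by
  simp [EA]

lemma EA_insert {n : ℕ} (x : Fin n → ℝ) (A : Finset (Fin n)) (a : Fin n) (ha : a ∉ A)
    (f : Finset (Fin n) → ℝ) :
    EA x (insert a A) f = (1 - x a) * EA x A f + x a * EA x A (fun S => f (insert a S)) := by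
  unfold EA
  rw [Finset.sum_powerset_insert ha, Finset.mul_sum, Finset.mul_sum]
  congr 1
  · apply Finset.sum_congr rfl
    intro S hS
    have hS' := Finset.mem_powerset.mp hS
    have haS : a ∉ S := fun h => ha (hS' h)
    rw [Finset.insert_sdiff_of_notMem _ haS, Finset.prod_insert (by simp [ha])]
    ring
  · apply Finset.sum_congr rfl
    intro S hS
    have hS' := Finset.mem_powerset.mp hS
    have haS : a ∉ S := fun h => ha (hS' h)
    have : insert a A \ insert a S = A \ S := by
      ext j
      simp only [Finset.mem_sdiff, Finset.mem_insert]
      constructor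
      · rintro ⟨h1, h2⟩
        tauto
      · rintro ⟨h1, h2⟩
        refine ⟨Or.inr h1, ?_⟩
        rintro (rfl | h)
        · exact ha h1
        · exact h2 h
    rw [this, Finset.prod_insert haS]
    ring

lemma EA_mono {n : ℕ} (x : Fin n → ℝ) (hx : ∀ j, x j ∈ Set.Icc (0:ℝ) 1) (A : Finset (Fin n))
    (f g : Finset (Fin n) → ℝ) (h : ∀ S, f S ≤ g S) : EA x A f ≤ EA x A g := by
  unfold EA
  apply Finset.sum_le_sum
  intro S _
  apply mul_le_mul_of_nonneg_left (h S)
  apply mul_nonneg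
  · exact Finset.prod_nonneg fun j _ => (hx j).1
  · exact Finset.prod_nonneg fun j _ => sub_nonneg.mpr (hx j).2

lemma EA_lin {n : ℕ} (x : Fin n → ℝ) (A : Finset (Fin n)) (c d : ℝ)
    (f g : Finset (Fin n) → ℝ) :
    EA x A (fun S => c * f S + d * g S) = c * EA x A f + d * EA x A g := by
  unfold EA
  rw [Finset.mul_sum, Finset.mul_sum, ← Finset.sum_add_distrib]
  apply Finset.sum_congr rfl
  intro S _
  ring

lemma EA_one {n : ℕ} (x : Fin n → ℝ) (A : Finset (Fin n)) : EA x A (fun _ => 1) = 1 := by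
  induction A using Finset.induction_on with
  | empty => simp [EA_empty]
  | insert a A ha ih => rw [EA_insert x A a ha, ih]; ring

lemma EA_harris {n : ℕ} (x : Fin n → ℝ) (hx : ∀ j, x j ∈ Set.Icc (0:ℝ) 1) (A : Finset (Fin n)) :
    ∀ f g : Finset (Fin n) → ℝ, Antitone f → Monotone g →
    EA x A (fun S => f S * g S) ≤ EA x A f * EA x A g := by
  induction A using Finset.induction_on with
  | empty => intro f g _ _; simp [EA_empty]
  | insert a A ha ih =>
    intro f g hf hg
    simp only [EA_insert x A a ha]
    have hi : Monotone (fun S : Finset (Fin n) => insert a S) :=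
      fun S T h => Finset.insert_subset_insert a h
    have h1 := ih f g hf hg
    have h2 := ih (fun S => f (insert a S)) (fun S => g (insert a S))
      (fun S T h => hf (hi h)) (fun S T h => hg (hi h))
    have h3 := EA_mono x hx A (fun S => f (insert a S)) f
      (fun S => hf (Finset.subset_insert a S))
    have h4 := EA_mono x hx A g (fun S => g (insert a S))
      (fun S => hg (Finset.subset_insert a S))
    obtain ⟨h5, h6⟩ := hx a
    have h6' : 0 ≤ 1 - x a := by linarith
    have h7 := mul_le_mul_of_nonneg_left h1 h6'
    have h8 := mul_le_mul_of_nonneg_left h2 h5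
    have h9 := mul_nonneg (mul_nonneg h5 h6') (mul_nonneg (sub_nonneg.mpr h3) (sub_nonneg.mpr h4))
    nlinarith [h7, h8, h9]

lemma bern (δ m : ℝ) (hδ : δ ∈ Set.Ioo (0:ℝ) 1) (h0 : 0 ≤ m) (h1 : m ≤ 1) :
    Real.exp (Real.log (1 - δ) * m) ≤ 1 - δ * m := by
  have hp : 0 < 1 - δ := by linarith [hδ.2]
  rw [← Real.rpow_def_of_pos hp]
  have := rpow_one_add_le_one_add_mul_self (s := -δ) (by linarith [hδ.2]) h0 h1
  rw [← sub_eq_add_neg] at this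
  linarith

lemma EA_chernoff (n : ℕ) (v : Finset (Fin n) → ℝ)
    (hmono : ∀ S T : Finset (Fin n), S ⊆ T → v S ≤ v T)
    (hsub : ∀ S T : Finset (Fin n), v S + v T ≥ v (S ∩ T) + v (S ∪ T))
    (h0 : v ∅ = 0)
    (hmarg : ∀ (S : Finset (Fin n)) (i : Fin n), v (insert i S) - v S ≤ 1)
    (x : Fin n → ℝ) (hx : ∀ j, x j ∈ Set.Icc (0:ℝ) 1)
    (δ : ℝ) (hδ : δ ∈ Set.Ioo (0:ℝ) 1) (A : Finset (Fin n)) :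
    EA x A (fun S => Real.exp (Real.log (1 - δ) * v S)) ≤ Real.exp (-δ * EA x A v) := by
  have hθ : Real.log (1 - δ) ≤ 0 :=
    Real.log_nonpos (by linarith [hδ.2]) (by linarith [hδ.1])
  induction A using Finset.induction_on with
  | empty => simp [EA_empty, h0]
  | insert a A ha ih =>
    obtain ⟨hx0, hx1⟩ := hx a
    set θ := Real.log (1 - δ) with hθd
    have hanti : ∀ S T : Finset (Fin n), S ⊆ T →
        v (insert a T) - v T ≤ v (insert a S) - v S := by
      intro S T hST
      by_cases haT : a ∈ T
      · rw [Finset.insert_eq_of_mem haT]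
        linarith [hmono S (insert a S) (Finset.subset_insert a S)]
      · have h := hsub (insert a S) T
        have e1 : insert a S ∩ T = S := by
          rw [Finset.insert_inter_of_notMem haT, Finset.inter_eq_left.mpr hST]
        have e2 : insert a S ∪ T = insert a T := by
          rw [Finset.insert_union, Finset.union_eq_right.mpr hST]
        rw [e1, e2] at h
        linarith
    have hf : Antitone (fun S => Real.exp (θ * v S)) := fun S T h =>
      Real.exp_le_exp.mpr (mul_le_mul_of_nonpos_left (hmono S T h) hθ)
    have hg : Monotone (fun S => (1 - x a) * 1 + x a * Real.exp (θ * (v (insert a S) - v S))) := by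
      intro S T h
      have := Real.exp_le_exp.mpr (mul_le_mul_of_nonpos_left (hanti S T h) hθ)
      have := mul_le_mul_of_nonneg_left this hx0
      simpa using this
    have hH := EA_harris x hx A _ _ hf hg
    have e : EA x (insert a A) (fun S => Real.exp (θ * v S)) =
        EA x A (fun S => Real.exp (θ * v S) *
          ((1 - x a) * 1 + x a * Real.exp (θ * (v (insert a S) - v S)))) := by
      rw [EA_insert x A a ha, ← EA_lin]
      congr 1
      ext S
      have : Real.exp (θ * v (insert a S)) =
          Real.exp (θ * v S) * Real.exp (θ * (v (insert a S) - v S)) := by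
        rw [← Real.exp_add]; ring_nf
      rw [this]; ring
    set D := EA x A (fun S => v (insert a S)) - EA x A v with hD
    have hgle : EA x A (fun S => (1 - x a) * 1 + x a * Real.exp (θ * (v (insert a S) - v S)))
        ≤ 1 - δ * (x a * D) := by
      have h1 := EA_mono x hx A
        (fun S => (1 - x a) * 1 + x a * Real.exp (θ * (v (insert a S) - v S)))
        (fun S => 1 * 1 + (-δ * x a) * (1 * v (insert a S) + (-1) * v S)) (by
          intro S
          have := bern δ (v (insert a S) - v S) hδ
            (by linarith [hmono S (insert a S) (Finset.subset_insert a S)]) (hmarg S a)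
          have := mul_le_mul_of_nonneg_left this hx0

          linarith)
      rw [EA_lin x A 1 (-δ * x a) (fun _ => 1) (fun S => 1 * v (insert a S) + (-1) * v S),
        EA_lin x A 1 (-1) (fun S => v (insert a S)) v, EA_one] at h1
      refine h1.trans (le_of_eq ?_)
      rw [hD]; ring
    have hexp : 1 - δ * (x a * D) ≤ Real.exp (-δ * (x a * D)) := by
      have := Real.add_one_le_exp (-δ * (x a * D))
      linarith
    have hgpos : 0 ≤ EA x A (fun S => (1 - x a) * 1 + x a * Real.exp (θ * (v (insert a S) - v S))) := by
      have := EA_mono x hx A (fun S => 0 * 1 + 0 * 1)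
        (fun S => (1 - x a) * 1 + x a * Real.exp (θ * (v (insert a S) - v S))) (by
          intro S
          have := mul_nonneg hx0 (Real.exp_pos (θ * (v (insert a S) - v S))).le

          linarith)
      rw [EA_lin x A 0 0 (fun _ => 1) (fun _ => 1)] at this
      linarith
    rw [e]
    refine hH.trans ?_
    refine (mul_le_mul ih (hgle.trans hexp) hgpos (Real.exp_pos _).le).trans (le_of_eq ?_)
    rw [← Real.exp_add, EA_insert x A a ha, hD]
    ring_nf

lemma log_bound (δ : ℝ) (hδ : δ ∈ Set.Ioo (0:ℝ) 1) :
    -Real.log (1 - δ) * (1 - δ) - δ ≤ -δ ^ 2 / 2 := by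
  have hder : ∀ y ∈ Set.Iio (1:ℝ), HasDerivAt
      (fun y => (1 - y) * Real.log (1 - y) + y - y ^ 2 / 2) (-Real.log (1 - y) - y) y := by
    intro y hy
    have hy' : (1 - y) ≠ 0 := by
      have : y < 1 := hy
      linarith
    have h1 : HasDerivAt (fun y : ℝ => 1 - y) (-1) y := by
      simpa using (hasDerivAt_id y).const_sub 1
    have h2 := ((h1.mul (h1.log hy')).add (hasDerivAt_id y)).sub
      (((hasDerivAt_id y).pow 2).div_const 2)
    refine h2.congr_deriv ?_
    have h3 : (1 - y) * (-1 / (1 - y)) = -1 := by field_simp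
    rw [h3]
    simp
  have hm : MonotoneOn (fun y : ℝ => (1 - y) * Real.log (1 - y) + y - y ^ 2 / 2) (Set.Ico 0 1) := by
    apply monotoneOn_of_deriv_nonneg (convex_Ico 0 1)
    · intro y hy
      exact (hder y hy.2).continuousAt.continuousWithinAt
    · intro y hy
      rw [interior_Ico] at hy
      exact (hder y hy.2).differentiableAt.differentiableWithinAt
    · intro y hy
      rw [interior_Ico] at hy
      rw [(hder y hy.2).deriv]
      have := Real.log_le_sub_one_of_pos (x := 1 - y) (by linarith [hy.2])
      linarith
  have := hm (a := 0) (b := δ) ⟨le_rfl, one_pos⟩ ⟨hδ.1.le, hδ.2⟩ hδ.1.le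
  simp at this
  linarith

theorem stmt7 (n : ℕ) (v : Finset (Fin n) → ℝ)
    (hmono : ∀ S T : Finset (Fin n), S ⊆ T → v S ≤ v T)
    (hsub : ∀ S T : Finset (Fin n), v S + v T ≥ v (S ∩ T) + v (S ∪ T))
    (h0 : v ∅ = 0)
    (hmarg : ∀ (S : Finset (Fin n)) (i : Fin n), v (insert i S) - v S ≤ 1)
    (x : Fin n → ℝ) (hx : ∀ j, x j ∈ Set.Icc (0:ℝ) 1)
    (δ : ℝ) (hδ : δ ∈ Set.Ioo (0:ℝ) 1)
    (μ θ t : ℝ) (hμ : μ = multilinear n v x)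
    (hθ : θ = Real.log (1 - δ)) (ht : t = (1 - δ) * μ) :
    Real.exp (-θ * t) *
      (∑ S : Finset (Fin n),
        ((∏ j ∈ S, x j) * ∏ j ∈ Sᶜ, (1 - x j)) * Real.exp (θ * v S)) ≤
      Real.exp (-δ ^ 2 * μ / 2) := by
  have hC := EA_chernoff n v hmono hsub h0 hmarg x hx δ hδ Finset.univ
  have hE : ∀ f : Finset (Fin n) → ℝ, EA x Finset.univ f =
      ∑ S : Finset (Fin n), ((∏ j ∈ S, x j) * ∏ j ∈ Sᶜ, (1 - x j)) * f S := by
    intro f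
    simp [EA, Finset.compl_eq_univ_sdiff]
  have hμE : EA x Finset.univ v = μ := by
    rw [hE, hμ, multilinear]
    exact Finset.sum_congr rfl fun S _ => mul_comm _ _
  have hμ0 : 0 ≤ μ := by
    rw [← hμE, hE]
    refine Finset.sum_nonneg fun S _ => mul_nonneg (mul_nonneg ?_ ?_) ?_
    · exact Finset.prod_nonneg fun j _ => (hx j).1
    · exact Finset.prod_nonneg fun j _ => sub_nonneg.mpr (hx j).2
    · rw [← h0]; exact hmono _ _ (Finset.empty_subset S)
  rw [hμE, hE, ← hθ] at hC
  refine (mul_le_mul_of_nonneg_left hC (Real.exp_pos _).le).trans ?_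
  rw [← Real.exp_add]
  apply Real.exp_le_exp.mpr
  have := mul_le_mul_of_nonneg_right (log_bound δ hδ) hμ0
  rw [ht, hθ]
  linarith
end

section
/- Let v be a monotone submodular set function on a finite ground set M with v(∅) = 0, and let R > 0. Let I be a finite index set, and for each i ∈ I let S_i ⊆ M be a nonempty set, w_i ≥ 0 a weight, and R'_i ≥ R a real with v({j}) ≤ R'_i for every j ∈ S_i. Then ∑_{i ∈ I} w_i · v^{(R)}(S_i) ≥ R · ∑_{i ∈ I} w_i · v(S_i) / R'_i, where v^{(R)} is the truncation of v by R. -/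
open MeasureTheory

theorem truncate_aux {M : Type*} (v : Finset M → ℝ)
    (hmono : ∀ S T : Finset M, S ⊆ T → v S ≤ v T)
    (h0 : v ∅ = 0) (R : ℝ) (hR : 0 < R) (S : Finset M) (R' : ℝ) (hRR' : R ≤ R')
    (hb : ∀ j ∈ S, v {j} ≤ R') : R / R' * v S ≤ truncate v R S := by
  have hnn : ∀ T, 0 ≤ v T := fun T => h0 ▸ hmono ∅ T (Finset.empty_subset T)
  have hR' : 0 < R' := lt_of_lt_of_le hR hRR'
  have ha0 : 0 ≤ R / R' := by positivity
  have ha1 : R / R' ≤ 1 := (div_le_one hR').2 hRR'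
  have hanti : Antitone (fun θ : ℝ => v (S.filter (fun j => θ * v {j} ≤ R))) := by
    intro a b hab
    apply hmono
    intro j hj
    rw [Finset.mem_filter] at hj ⊢
    exact ⟨hj.1, le_trans (mul_le_mul_of_nonneg_right hab (hnn _)) hj.2⟩
  unfold truncate
  rw [← intervalIntegral.integral_add_adjacent_intervals (b := R / R')
    hanti.intervalIntegrable hanti.intervalIntegrable]
  have h2 : 0 ≤ ∫ θ in (R / R')..1, v (S.filter (fun j => θ * v {j} ≤ R)) :=
    intervalIntegral.integral_nonneg ha1 (fun θ _ => hnn _)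
  have h1 : ∫ θ in (0:ℝ)..(R / R'), v (S.filter (fun j => θ * v {j} ≤ R))
      = ∫ θ in (0:ℝ)..(R / R'), v S := by
    apply intervalIntegral.integral_congr
    intro θ hθ
    rw [Set.uIcc_of_le ha0] at hθ
    have : S.filter (fun j => θ * v {j} ≤ R) = S := by
      apply Finset.filter_true_of_mem
      intro j hj
      calc θ * v {j} ≤ R / R' * R' := mul_le_mul hθ.2 (hb j hj) (hnn _) ha0
        _ = R := by field_simp
    simp only [this]
  rw [h1, intervalIntegral.integral_const, smul_eq_mul, sub_zero]
  linarith

theorem stmt13 {M : Type*} [Fintype M] [DecidableEq M]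
    (v : Finset M → ℝ)
    (hmono : ∀ S T : Finset M, S ⊆ T → v S ≤ v T)
    (hsub : ∀ S T : Finset M, v S + v T ≥ v (S ∩ T) + v (S ∪ T))
    (h0 : v ∅ = 0) (R : ℝ) (hR : 0 < R)
    {ι : Type*} [Fintype ι]
    (S : ι → Finset M) (w : ι → ℝ) (R' : ι → ℝ)
    (hne : ∀ i, (S i).Nonempty)
    (hw : ∀ i, 0 ≤ w i)
    (hRR' : ∀ i, R ≤ R' i)
    (hbound : ∀ i, ∀ j ∈ S i, v {j} ≤ R' i) :
    ∑ i, w i * truncate v R (S i) ≥ R * ∑ i, w i * v (S i) / R' i := by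
  rw [ge_iff_le, Finset.mul_sum]
  apply Finset.sum_le_sum
  intro i _
  have h := mul_le_mul_of_nonneg_left
    (truncate_aux v hmono h0 R hR (S i) (R' i) (hRR' i) (hbound i)) (hw i)
  calc R * (w i * v (S i) / R' i) = w i * (R / R' i * v (S i)) := by ring
    _ ≤ _ := h
end

section
/- Let G be a finite bipartite multigraph whose vertex set is the disjoint union of a set N of agents and a set M of items: G has a finite edge set E, maps ag : E → N and it : E → M giving the endpoints of each edge, and a subset of edges designated as marked (the rest unmarked). Let x : E → [0,1] satisfy: (I1) for every item j ∈ M, ∑_{e ∈ E : it(e) = j} x_e = 1; and (I2) for every agent i ∈ N, ∑_{e ∈ E marked : ag(e) = i} x_e = 1. Let F = {e ∈ E : 0 < x_e < 1} and suppose F is nonempty. Then F contains either (A) a marked cycle: a nonempty list of distinct marked edges e_1, f_1, e_2, f_2, …, e_k, f_k in F with ag(e_a) = ag(f_a) =: i_a and it(f_a) = it(e_{a+1 mod k}) =: j_a for all a, where the agents i_1,…,i_k are pairwise distinct and the items j_1,…,j_k are pairwise distinct; or (B) a pseudo-marked path: two distinct unmarked edges g, g' in F and (possibly zero) marked edges e_2,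 f_2, e_3, f_3, …, e_k, f_k in F, all distinct, such that the marked edges form a simple path j_1, i_2, j_2, …, i_k, j_k with pairwise distinct items j_1,…,j_k and pairwise distinct agents i_2,…,i_k (where it(e_a) = j_{a−1}, ag(e_a) = ag(f_a) = i_a, it(f_a) = j_a), and it(g) = j_1, it(g') = j_k. -/
def CycA {N M E : Type*} (ag : E → N) (it : E → M) (P : E → Prop) : Prop :=
  ∃ (k : ℕ) (e f : Fin (k + 1) → E),
      (∀ a, P (e a)) ∧ (∀ a, P (f a)) ∧
      (∀ a, ag (e a) = ag (f a)) ∧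
      (∀ a, it (f a) = it (e (a + 1))) ∧
      Function.Injective e ∧ Function.Injective f ∧ (∀ a b, e a ≠ f b) ∧
      Function.Injective (fun a => ag (e a)) ∧
      Function.Injective (fun a => it (f a))

lemma cycA_of {N M E : Type*} (ag : E → N) (it : E → M) (P : E → Prop)
    (k : ℕ) (e f : ℕ → E)
    (h1 : ∀ b ≤ k, P (e b) ∧ P (f b) ∧ e b ≠ f b ∧ ag (e b) = ag (f b))
    (h2 : ∀ b < k, it (f b) = it (e (b + 1))) (h3 : it (f k) = it (e 0))
    (h4 : ∀ a ≤ k, ∀ b ≤ k, ag (e a) = ag (e b) → a = b)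
    (h5 : ∀ a ≤ k, ∀ b ≤ k, it (f a) = it (f b) → a = b) : CycA ag it P := by
  have hl : ∀ a : Fin (k + 1), (a : ℕ) ≤ k := fun a => Nat.lt_succ_iff.mp a.2
  refine ⟨k, fun a => e a, fun a => f a, fun a => (h1 a (hl a)).1, fun a => (h1 a (hl a)).2.1,
    fun a => (h1 a (hl a)).2.2.2, ?_, ?_, ?_, ?_, ?_, ?_⟩
  · intro a
    by_cases h : a = Fin.last k
    · subst h
      simpa using h3
    · have h' : (a : ℕ) < k := Fin.val_lt_last h
      have : ((a + 1 : Fin (k + 1)) : ℕ) = a + 1 := Fin.val_add_one_of_lt (Fin.lt_last_iff_ne_last.mpr h)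
      simp only [this]
      exact h2 a h'
  · intro a b h
    exact Fin.ext (h4 a (hl a) b (hl b) (congrArg ag h))
  · intro a b h
    exact Fin.ext (h5 a (hl a) b (hl b) (congrArg it h))
  · intro a b h
    have h' : e a = f b := h
    have := h4 a (hl a) b (hl b) (by rw [h', (h1 b (hl b)).2.2.2])
    rw [this] at h'
    exact (h1 b (hl b)).2.2.1 h'
  · intro a b h
    exact Fin.ext (h4 a (hl a) b (hl b) h)
  · intro a b h
    exact Fin.ext (h5 a (hl a) b (hl b) h)

def PathP {N M E : Type*} (ag : E → N) (it : E → M) (P : E → Prop)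
    (m : ℕ) (j : ℕ → M) (e f : ℕ → E) : Prop :=
  (∀ a < m, P (e a) ∧ P (f a) ∧ e a ≠ f a ∧ ag (e a) = ag (f a) ∧ it (e a) = j a ∧
    it (f a) = j (a + 1)) ∧
  (∀ a ≤ m, ∀ b ≤ m, j a = j b → a = b) ∧
  (∀ a < m, ∀ b < m, ag (e a) = ag (e b) → a = b)

lemma extend {N M E : Type*} (ag : E → N) (it : E → M) (P : E → Prop)
    (hP : ∀ d, P d → ∃ d', d' ≠ d ∧ P d' ∧ ag d' = ag d)
    (hA : ¬ CycA ag it P) (m : ℕ) (j : ℕ → M) (e f : ℕ → E) (hp : PathP ag it P m j e f)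
    (d : E) (hd : P d) (hdj : it d = j m) (hne : ∀ a < m, d ≠ f a) :
    ∃ j' e' f', PathP ag it P (m + 1) j' e' f' ∧ j' 0 = j 0 := by
  classical
  obtain ⟨p1, p2, p3⟩ := hp
  have hnew : ∀ a < m, ag (e a) ≠ ag d := by
    intro a ha hag
    apply hA
    refine cycA_of ag it P (m - 1 - a) (fun b => if b = 0 then d else e (a + b))
      (fun b => f (a + b)) ?_ ?_ ?_ ?_ ?_
    · intro b hb
      have := p1 (a + b) (by omega)
      by_cases h0 : b = 0
      · subst h0
        simp only [if_true, Nat.add_zero] at this ⊢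
        exact ⟨hd, this.2.1, hne a ha, by rw [← hag]; exact this.2.2.2.1⟩
      · simp only [h0, if_false]
        exact ⟨this.1, this.2.1, this.2.2.1, this.2.2.2.1⟩
    · intro b hb
      simp only [Nat.succ_ne_zero, if_false]
      rw [(p1 (a + b) (by omega)).2.2.2.2.2, ← Nat.add_assoc,
        (p1 (a + b + 1) (by omega)).2.2.2.2.1]
    · simp only [if_true]
      rw [(p1 (a + (m - 1 - a)) (by omega)).2.2.2.2.2, hdj]
      congr 1; omega
    · have key : ∀ b, ag (if b = 0 then d else e (a + b)) = ag (e (a + b)) := by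
        intro b
        split_ifs with h
        · subst h; exact hag.symm
        · rfl
      intro b hb c hc h
      simp only [key] at h
      have := p3 _ (by omega) _ (by omega) h
      omega
    · intro b hb c hc h
      beta_reduce at h
      rw [(p1 (a + b) (by omega)).2.2.2.2.2, (p1 (a + c) (by omega)).2.2.2.2.2] at h
      have := p2 _ (by omega) _ (by omega) h
      omega
  obtain ⟨d', hd'ne, hd'P, hd'ag⟩ := hP d hd
  -- extended functions
  obtain ⟨e', he1, he2⟩ : ∃ e' : ℕ → E, (∀ a < m, e' a = e a) ∧ e' m = d :=
    ⟨fun a => if a = m then d else e a, fun a ha => if_neg (by omega), if_pos rfl⟩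
  obtain ⟨f', hf1, hf2⟩ : ∃ f' : ℕ → E, (∀ a < m, f' a = f a) ∧ f' m = d' :=
    ⟨fun a => if a = m then d' else f a, fun a ha => if_neg (by omega), if_pos rfl⟩
  obtain ⟨j', hj1, hj2⟩ : ∃ j' : ℕ → M, (∀ a ≤ m, j' a = j a) ∧ j' (m + 1) = it d' :=
    ⟨fun a => if a = m + 1 then it d' else j a, fun a ha => if_neg (by omega), if_pos rfl⟩
  have q1 : ∀ a < m + 1, P (e' a) ∧ P (f' a) ∧ e' a ≠ f' a ∧ ag (e' a) = ag (f' a) ∧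
      it (e' a) = j' a ∧ it (f' a) = j' (a + 1) := by
    intro a ha
    rcases Nat.lt_succ_iff_lt_or_eq.mp ha with h | h
    · rw [he1 a h, hf1 a h, hj1 a h.le, hj1 (a + 1) h]
      exact p1 a h
    · subst h
      rw [he2, hf2, hj2, hj1 a le_rfl]
      exact ⟨hd, hd'P, hd'ne.symm, hd'ag.symm, hdj, rfl⟩
  have q3 : ∀ a < m + 1, ∀ b < m + 1, ag (e' a) = ag (e' b) → a = b := by
    intro a ha b hb h
    rcases Nat.lt_succ_iff_lt_or_eq.mp ha with h1 | h1 <;>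
      rcases Nat.lt_succ_iff_lt_or_eq.mp hb with h2 | h2
    · rw [he1 a h1, he1 b h2] at h; exact p3 a h1 b h2 h
    · rw [h2, he1 a h1, he2] at h; exact absurd h (hnew a h1)
    · rw [h1, he1 b h2, he2] at h; exact absurd h.symm (hnew b h2)
    · omega
  have q0 : ∀ a ≤ m, j a ≠ it d' := by
    intro a ha haj
    apply hA
    refine cycA_of ag it P (m - a) (fun b => e' (a + b)) (fun b => f' (a + b)) ?_ ?_ ?_ ?_ ?_
    · intro b hb
      have := q1 (a + b) (by omega)
      exact ⟨this.1, this.2.1, this.2.2.1, this.2.2.2.1⟩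
    · intro b hb
      beta_reduce
      rw [(q1 (a + b) (by omega)).2.2.2.2.2, ← Nat.add_assoc,
        (q1 (a + b + 1) (by omega)).2.2.2.2.1]
    · simp only [Nat.add_zero]
      rw [(q1 a (by omega)).2.2.2.2.1, hj1 a ha, haj, Nat.add_sub_cancel' ha, hf2]
    · intro b hb c hc h
      have := q3 _ (by omega) _ (by omega) h
      omega
    · intro b hb c hc h
      beta_reduce at h
      rcases Nat.lt_or_ge (a + b) m with h1 | h1 <;> rcases Nat.lt_or_ge (a + c) m with h2 | h2
      · rw [(q1 (a + b) (by omega)).2.2.2.2.2, (q1 (a + c) (by omega)).2.2.2.2.2,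
          hj1 _ (by omega), hj1 _ (by omega)] at h
        have := p2 _ (by omega) _ (by omega) h
        omega
      · rw [(q1 (a + b) (by omega)).2.2.2.2.2, hj1 _ (by omega),
          show a + c = m by omega, hf2, ← haj] at h
        have := p2 _ (by omega) _ (by omega) h
        omega
      · rw [(q1 (a + c) (by omega)).2.2.2.2.2, hj1 (a + c + 1) (by omega),
          show a + b = m by omega, hf2, ← haj] at h
        have := p2 _ (by omega) _ (by omega) h
        omega
      · omega
  refine ⟨j', e', f', ⟨q1, ?_, q3⟩, hj1 0 (Nat.zero_le _)⟩
  intro a ha b hb h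
  rcases Nat.lt_or_ge m a with h1 | h1 <;> rcases Nat.lt_or_ge m b with h2 | h2
  · omega
  · rw [show a = m + 1 by omega, hj2, hj1 b h2] at h; exact absurd h.symm (q0 b h2)
  · rw [show b = m + 1 by omega, hj2, hj1 a h1] at h; exact absurd h (q0 a h1)
  · rw [hj1 a h1, hj1 b h2] at h; exact p2 a h1 b h2 h

lemma other_frac {E : Type*} [Fintype E] (x : E → ℝ) (hx : ∀ e, x e ∈ Set.Icc (0:ℝ) 1)
    (p : E → Prop) [DecidablePred p] (h : (∑ e : E, if p e then x e else 0) = 1)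
    (d : E) (hd : p d) (h0 : 0 < x d) (h1 : x d < 1) :
    ∃ d', d' ≠ d ∧ p d' ∧ 0 < x d' ∧ x d' < 1 := by
  classical
  rw [← Finset.add_sum_erase _ _ (Finset.mem_univ d), if_pos hd] at h
  have hne : (∑ e ∈ Finset.univ.erase d, if p e then x e else 0) ≠ 0 := by
    intro h'; rw [h'] at h; linarith
  obtain ⟨d', hd', hd'0⟩ := Finset.exists_ne_zero_of_sum_ne_zero hne
  have hle := Finset.single_le_sum (f := fun e => if p e then x e else 0)
    (fun i _ => by
      show (0:ℝ) ≤ if p i then x i else 0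
      split_ifs
      · exact (hx i).1
      · exact le_rfl) hd'
  by_cases hp : p d'
  · simp only [hp, if_true] at hle hd'0
    exact ⟨d', Finset.ne_of_mem_erase hd', hp, lt_of_le_of_ne (hx d').1 (Ne.symm hd'0),
      by linarith⟩
  · simp [hp] at hd'0

theorem stmt15 {N M E : Type*} [Fintype E] [DecidableEq N] [DecidableEq M]
    (ag : E → N) (it : E → M) (marked : E → Prop) [DecidablePred marked]
    (x : E → ℝ) (hx : ∀ e, x e ∈ Set.Icc (0:ℝ) 1)
    (hI1 : ∀ j : M, (∑ e : E, if it e = j then x e else 0) = 1)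
    (hI2 : ∀ i : N, (∑ e : E, if marked e ∧ ag e = i then x e else 0) = 1)
    (hF : ∃ e : E, 0 < x e ∧ x e < 1) :
    -- (A) a marked cycle: marked edges e_1, f_1, …, e_{k+1}, f_{k+1}, all distinct and
    -- strictly fractional, with ag (e_a) = ag (f_a) =: i_a, it (f_a) = it (e_{a+1}) =: j_a
    -- (cyclically), the agents i_a pairwise distinct and the items j_a pairwise distinct
    (∃ (k : ℕ) (e f : Fin (k + 1) → E),
      (∀ a, (0 < x (e a) ∧ x (e a) < 1) ∧ marked (e a)) ∧
      (∀ a, (0 < x (f a) ∧ x (f a) < 1) ∧ marked (f a)) ∧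
      (∀ a, ag (e a) = ag (f a)) ∧
      (∀ a, it (f a) = it (e (a + 1))) ∧
      Function.Injective e ∧ Function.Injective f ∧ (∀ a b, e a ≠ f b) ∧
      Function.Injective (fun a => ag (e a)) ∧
      Function.Injective (fun a => it (f a))) ∨
    -- (B) a pseudo-marked path: two distinct strictly fractional unmarked edges g, g'
    -- together with distinct strictly fractional marked edges forming a simple path
    -- j_1, i_2, j_2, …, i_{m+1}, j_{m+1} (items j pairwise distinct, agents pairwise
    -- distinct), where it g = j_1 and it g' = j_{m+1}
    (∃ (m : ℕ) (j : Fin (m + 1) → M) (e f : Fin m → E) (g g' : E),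
      g ≠ g' ∧ ¬marked g ∧ ¬marked g' ∧
      (0 < x g ∧ x g < 1) ∧ (0 < x g' ∧ x g' < 1) ∧
      it g = j 0 ∧ it g' = j (Fin.last m) ∧
      Function.Injective j ∧
      (∀ a, (0 < x (e a) ∧ x (e a) < 1) ∧ marked (e a)) ∧
      (∀ a, (0 < x (f a) ∧ x (f a) < 1) ∧ marked (f a)) ∧
      (∀ a : Fin m, ag (e a) = ag (f a)) ∧
      (∀ a : Fin m, it (e a) = j a.castSucc) ∧
      (∀ a : Fin m, it (f a) = j a.succ) ∧
      Function.Injective e ∧ Function.Injective f ∧ (∀ a b, e a ≠ f b) ∧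
      Function.Injective (fun a => ag (e a))) := by
  classical
  have hP : ∀ d, ((0 < x d ∧ x d < 1) ∧ marked d) →
      ∃ d', d' ≠ d ∧ ((0 < x d' ∧ x d' < 1) ∧ marked d') ∧ ag d' = ag d := by
    rintro d ⟨⟨h0, h1⟩, hm⟩
    obtain ⟨d', h, ⟨h2, h3⟩, h4⟩ := other_frac x hx _ (hI2 (ag d)) d ⟨hm, rfl⟩ h0 h1
    exact ⟨d', h, ⟨h4, h2⟩, h3⟩
  have hQ : ∀ d, (0 < x d ∧ x d < 1) →
      ∃ d', d' ≠ d ∧ (0 < x d' ∧ x d' < 1) ∧ it d' = it d := by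
    rintro d ⟨h0, h1⟩
    obtain ⟨d', h, h2, h4⟩ := other_frac x hx _ (hI1 (it d)) d rfl h0 h1
    exact ⟨d', h, h4, h2⟩
  refine or_iff_not_imp_left.mpr fun hA => ?_
  replace hA : ¬ CycA ag it (fun e => (0 < x e ∧ x e < 1) ∧ marked e) := hA
  obtain ⟨g, hg, hgm⟩ : ∃ g, (0 < x g ∧ x g < 1) ∧
      (marked g → ∀ d, (0 < x d ∧ x d < 1) → marked d) := by
    by_cases h : ∃ g, (0 < x g ∧ x g < 1) ∧ ¬ marked g
    · obtain ⟨g, h1, h2⟩ := h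
      exact ⟨g, h1, fun h => absurd h h2⟩
    · push Not at h
      obtain ⟨g, hg⟩ := hF
      exact ⟨g, hg, fun _ => h⟩
  by_contra hB
  have main : ∀ m, ∃ j e f, PathP ag it (fun e => (0 < x e ∧ x e < 1) ∧ marked e) m j e f ∧
      j 0 = it g := by
    intro m
    induction m with
    | zero =>
      refine ⟨fun _ => it g, fun _ => g, fun _ => g, ⟨?_, ?_, ?_⟩, rfl⟩
      · intro a ha; omega
      · intro a ha b hb _; omega
      · intro a ha; omega
    | succ m ih =>
      obtain ⟨j, e, f, hp, hj0⟩ := ih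
      have ⟨p1, p2, p3⟩ := hp
      obtain ⟨d, hd, hdj, hdf, hdg⟩ : ∃ d, (0 < x d ∧ x d < 1) ∧ it d = j m ∧
          (∀ a < m, d ≠ f a) ∧ d ≠ g := by
        rcases Nat.eq_zero_or_pos m with h0 | h0
        · subst h0
          obtain ⟨d, h1, h2, h3⟩ := hQ g hg
          exact ⟨d, h2, h3.trans hj0.symm, fun a ha => absurd ha (by omega), h1⟩
        · obtain ⟨q1, q2, q3, q4, q5, q6⟩ := p1 (m - 1) (by omega)
          rw [Nat.sub_add_cancel h0] at q6
          obtain ⟨d, h1, h2, h3⟩ := hQ _ q2.1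
          refine ⟨d, h2, h3.trans q6, ?_, ?_⟩
          · intro a ha hda
            rw [hda, q6, (p1 a ha).2.2.2.2.2] at h3
            have := p2 _ (by omega) _ (by omega) h3
            rw [hda, show a = m - 1 by omega] at h1
            exact h1 rfl
          · intro hdg
            rw [hdg, q6, ← hj0] at h3
            have := p2 _ (by omega) _ (by omega) h3
            omega
      by_cases hdm : marked d
      · obtain ⟨j', e', f', h1, h2⟩ := extend ag it _ hP hA m j e f hp d ⟨hd, hdm⟩ hdj hdf
        exact ⟨j', e', f', h1, h2.trans hj0⟩
      · exfalso
        apply hB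
        refine ⟨m, fun a => j a, fun a => e a, fun a => f a, g, d, hdg.symm,
          fun h => hdm (hgm h d hd), hdm, hg, hd, hj0.symm, hdj, ?_,
          fun a => (p1 a a.2).1, fun a => (p1 a a.2).2.1, fun a => (p1 a a.2).2.2.2.1,
          fun a => (p1 a a.2).2.2.2.2.1, fun a => (p1 a a.2).2.2.2.2.2, ?_, ?_, ?_, ?_⟩
        · intro a b h
          exact Fin.ext (p2 a (by omega) b (by omega) h)
        · intro a b h
          exact Fin.ext (p3 a a.2 b b.2 (congrArg ag h))
        · intro a b h
          have := congrArg ag h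
          simp only [] at this
          rw [← (p1 a a.2).2.2.2.1, ← (p1 b b.2).2.2.2.1] at this
          exact Fin.ext (p3 a a.2 b b.2 this)
        · intro a b h
          have h' : e a = f b := h
          have := p3 a a.2 b b.2 (by rw [h', (p1 b b.2).2.2.2.1])
          rw [this] at h'
          exact (p1 b b.2).2.2.1 h'
        · intro a b h
          exact Fin.ext (p3 a a.2 b b.2 h)
  obtain ⟨j, e, f, ⟨p1, p2, p3⟩, -⟩ := main (Fintype.card E + 1)
  have := Fintype.card_le_of_injective (fun a : Fin (Fintype.card E + 1) => e a)
    (fun a b h => Fin.ext (p3 a a.2 b b.2 (congrArg ag h)))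
  simp at this
end
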